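/- Interval (convexity) property for node-labeled trees: let T be a finite tree whose vertices are labeled 0 or 1. If there exist connected subgraphs of T of size i containing j₁ ones and j₂ ones respectively, then for every j with j₁ ≤ j ≤ j₂ there exists a connected subgraph of T of size i containing exactly j ones. -/

import Mathlib

namespace SimpleGraph

variable {V : Type*} {G : SimpleGraph V}

lemma exists_adj_of_ssubset_of_connected_induce {C U : Finset V}
    (hU : (G.induce (U : Set V)).Connected) (hC : C.Nonempty) (hCU : C ⊂ U) :
    ∃ c ∈ C, ∃ w ∈ U, w ∉ C ∧ G.Adj c w := by
  obtain ⟨a, ha⟩ := hC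
  obtain ⟨b, hb, hbC⟩ := Finset.exists_of_ssubset hCU
  obtain ⟨p⟩ := hU.preconnected ⟨a, hCU.subset ha⟩ ⟨b, hb⟩
  obtain ⟨d, -, hd, hd'⟩ := p.exists_boundary_dart {x | x.1 ∈ C} ha hbC
  exact ⟨d.fst, hd, d.snd, d.snd.2, hd', d.adj⟩

lemma connected_induce_finset_singleton (a : V) :
    (G.induce (({a} : Finset V) : Set V)).Connected := by
  rw [Finset.coe_singleton]
  simp

variable [DecidableEq V]

/-- `U'` is a connected set obtained from `U` by exchanging one vertex. -/
def ConnectedExchange (G : SimpleGraph V) (U U' : Finset V) : Prop :=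
  ∃ v ∈ U, ∃ w ∉ U, U' = insert w (U.erase v) ∧ (G.induce (U' : Set V)).Connected

lemma connected_induce_insert {C : Finset V} (hC : (G.induce (C : Set V)).Connected)
    {c w : V} (hc : c ∈ C) (h : G.Adj c w) :
    (G.induce ((insert w C : Finset V) : Set V)).Connected := by
  have hU : ((insert w C : Finset V) : Set V) = ↑C ∪ {c, w} := by
    ext x
    simp only [Finset.coe_insert, Set.mem_insert_iff, Set.mem_union, Set.mem_singleton_iff,
      Finset.mem_coe]
    grind
  rw [hU]
  exact induce_union_connected hC.preconnected (induce_pair_connected_of_adj h).preconnected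
    ⟨c, hc, Set.mem_insert c _⟩

lemma exists_connected_induce_erase {U C : Finset V} (hU : (G.induce (U : Set V)).Connected)
    (hC : (G.induce (C : Set V)).Connected) (hCU : C ⊂ U) :
    ∃ v ∈ U, v ∉ C ∧ (G.induce ((U.erase v : Finset V) : Set V)).Connected := by
  induction h : (U \ C).card using Nat.strong_induction_on generalizing C with
  | _ n ih =>
    obtain ⟨c, hc, w, hw, hwC, hadj⟩ := exists_adj_of_ssubset_of_connected_induce hU
      (Finset.coe_nonempty.1 (Set.nonempty_coe_sort.1 hC.nonempty)) hCU
    have hsub : insert w C ⊆ U := Finset.insert_subset hw hCU.subset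
    rcases hsub.eq_or_ssubset with heq | hss
    · refine ⟨w, hw, hwC, ?_⟩
      rwa [← heq, Finset.erase_insert hwC]
    · obtain ⟨v, hv, hvC, hconn⟩ := ih (U \ insert w C).card
        (h ▸ Finset.card_lt_card (by
          refine Finset.ssubset_iff_subset_ne.2
            ⟨Finset.sdiff_subset_sdiff subset_rfl (Finset.subset_insert w C), fun he => ?_⟩
          have : w ∈ U \ insert w C := he ▸ Finset.mem_sdiff.2 ⟨hw, hwC⟩
          simp at this))
        (connected_induce_insert hC hc hadj) hss rfl
      exact ⟨v, hv, fun hvc => hvC (Finset.mem_insert_of_mem hvc), hconn⟩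

lemma ConnectedExchange.card_eq {U U' : Finset V} (h : G.ConnectedExchange U U') :
    U'.card = U.card := by
  obtain ⟨v, hv, w, hw, rfl, -⟩ := h
  rw [Finset.card_insert_of_notMem (fun h => hw (Finset.mem_of_mem_erase h)),
    Finset.card_erase_add_one hv]

lemma ConnectedExchange.connected {U U' : Finset V} (h : G.ConnectedExchange U U') :
    (G.induce (U' : Set V)).Connected := by
  obtain ⟨v, hv, w, hw, rfl, hconn⟩ := h
  exact hconn

lemma ConnectedExchange.card_filter_le {U U' : Finset V} (h : G.ConnectedExchange U U')
    (p : V → Prop) [DecidablePred p] : (U'.filter p).card ≤ (U.filter p).card + 1 := by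
  obtain ⟨v, hv, w, hw, rfl, -⟩ := h
  calc ((insert w (U.erase v)).filter p).card
      ≤ (insert w (U.filter p)).card := Finset.card_le_card (by
        intro x hx
        simp only [Finset.mem_filter, Finset.mem_insert, Finset.mem_erase] at hx ⊢
        tauto)
    _ ≤ _ := Finset.card_insert_le _ _

lemma connected_of_reflTransGen_connectedExchange {U U' : Finset V}
    (hU : (G.induce (U : Set V)).Connected)
    (h : Relation.ReflTransGen G.ConnectedExchange U U') :
    (G.induce (U' : Set V)).Connected ∧ U'.card = U.card := by
  induction h with
  | refl => exact ⟨hU, rfl⟩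
  | tail _ hs ih => exact ⟨hs.connected, hs.card_eq.trans ih.2⟩

/-- A connected set can be moved by exchanges so as to absorb a vertex adjacent to a proper
connected subset, keeping that subset. -/
lemma exists_connectedExchange_insert_subset {U C : Finset V}
    (hU : (G.induce (U : Set V)).Connected) (hC : (G.induce (C : Set V)).Connected)
    (hCU : C ⊂ U) {c w : V} (hc : c ∈ C) (h : G.Adj c w) :
    ∃ U', Relation.ReflTransGen G.ConnectedExchange U U' ∧ insert w C ⊆ U' := by
  by_cases hw : w ∈ U
  · exact ⟨U, .refl, Finset.insert_subset hw hCU.subset⟩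
  obtain ⟨v, hv, hvC, hconn⟩ := exists_connected_induce_erase hU hC hCU
  have hsub : C ⊆ U.erase v := Finset.subset_erase.2 ⟨hCU.subset, hvC⟩
  exact ⟨insert w (U.erase v),
    .single ⟨v, hv, w, hw, rfl, connected_induce_insert hconn (hsub hc) h⟩,
    Finset.insert_subset_insert w hsub⟩

lemma exists_reflTransGen_connectedExchange_mem {a b : V} (p : G.Walk a b) {U : Finset V}
    (hU : (G.induce (U : Set V)).Connected) (ha : a ∈ U) :
    ∃ U', Relation.ReflTransGen G.ConnectedExchange U U' ∧ b ∈ U' := by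
  induction p generalizing U with
  | nil => exact ⟨U, .refl, ha⟩
  | @cons a x b h p ih =>
    obtain ⟨U', hU', hx⟩ : ∃ U', Relation.ReflTransGen G.ConnectedExchange U U' ∧ x ∈ U' := by
      rcases (Finset.singleton_subset_iff.2 ha).eq_or_ssubset with rfl | hss
      · exact ⟨{x}, .single ⟨a, ha, x, by simpa using h.ne', by simp,
          connected_induce_finset_singleton x⟩, by simp⟩
      · obtain ⟨U', hU', hsub⟩ := exists_connectedExchange_insert_subset hU
          (connected_induce_finset_singleton a) hss (Finset.mem_singleton_self a) h
        exact ⟨U', hU', hsub (Finset.mem_insert_self _ _)⟩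
    obtain ⟨U'', hU'', hb⟩ := ih (connected_of_reflTransGen_connectedExchange hU hU').1 hx
    exact ⟨U'', hU'.trans hU'', hb⟩

lemma reflTransGen_connectedExchange_of_subset {U W C : Finset V}
    (hU : (G.induce (U : Set V)).Connected) (hW : (G.induce (W : Set V)).Connected)
    (hC : (G.induce (C : Set V)).Connected) (hcard : U.card = W.card)
    (hCU : C ⊆ U) (hCW : C ⊆ W) : Relation.ReflTransGen G.ConnectedExchange U W := by
  induction h : W.card - C.card using Nat.strong_induction_on generalizing U C with
  | _ n ih =>
    rcases hCW.eq_or_ssubset with rfl | hss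
    · rw [Finset.eq_of_subset_of_card_le hCU hcard.le]
    have hlt := Finset.card_lt_card hss
    obtain ⟨c, hc, w, hw, hwC, hadj⟩ := exists_adj_of_ssubset_of_connected_induce hW
      (Finset.coe_nonempty.1 (Set.nonempty_coe_sort.1 hC.nonempty)) hss
    have hssU : C ⊂ U := Finset.ssubset_iff_subset_ne.2 ⟨hCU, by rintro rfl; omega⟩
    obtain ⟨U', hU', hsub⟩ := exists_connectedExchange_insert_subset hU hC hssU hc hadj
    obtain ⟨hconn, hcard'⟩ := connected_of_reflTransGen_connectedExchange hU hU'
    refine hU'.trans (ih (W.card - (insert w C).card) ?_ hconn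
      (connected_induce_insert hC hc hadj) (hcard'.trans hcard) hsub
      (Finset.insert_subset hw hss.subset) rfl)
    rw [Finset.card_insert_of_notMem hwC]
    omega

/-- In a connected graph, any two connected vertex sets of the same size are linked by
exchanges through connected sets. -/
theorem Connected.reflTransGen_connectedExchange (hG : G.Connected) {U W : Finset V}
    (hU : (G.induce (U : Set V)).Connected) (hW : (G.induce (W : Set V)).Connected)
    (hcard : U.card = W.card) : Relation.ReflTransGen G.ConnectedExchange U W := by
  obtain ⟨⟨a, ha⟩⟩ := hU.nonempty
  obtain ⟨⟨b, hb⟩⟩ := hW.nonempty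
  obtain ⟨p⟩ := hG.preconnected a b
  obtain ⟨U', hU', hbU'⟩ := exists_reflTransGen_connectedExchange_mem p hU ha
  obtain ⟨hconn, hcard'⟩ := connected_of_reflTransGen_connectedExchange hU hU'
  exact hU'.trans (reflTransGen_connectedExchange_of_subset hconn hW
    (connected_induce_finset_singleton b) (hcard'.trans hcard)
    (Finset.singleton_subset_iff.2 hbU') (Finset.singleton_subset_iff.2 hb))

end SimpleGraph


/-- Intermediate value property for ones-counts of connected `i`-subsets of a tree. -/
theorem stmt_6 {V : Type*} [Fintype V] [DecidableEq V] (T : SimpleGraph V)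
    (hT : T.IsTree) (lab : V → Bool) (i j₁ j₂ j : ℕ) (U₁ U₂ : Finset V)
    (h₁c : (T.induce (U₁ : Set V)).Connected) (h₂c : (T.induce (U₂ : Set V)).Connected)
    (h₁i : U₁.card = i) (h₂i : U₂.card = i)
    (h₁j : (U₁.filter fun v => lab v = true).card = j₁)
    (h₂j : (U₂.filter fun v => lab v = true).card = j₂)
    (hle₁ : j₁ ≤ j) (hle₂ : j ≤ j₂) :
    ∃ U : Finset V, U.card = i ∧ (T.induce (U : Set V)).Connected ∧
      (U.filter fun v => lab v = true).card = j := by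
  subst h₁i h₁j h₂j
  have h := hT.connected.reflTransGen_connectedExchange h₁c h₂c h₂i.symm
  clear h₂c h₂i
  induction h with
  | refl => exact ⟨U₁, rfl, h₁c, le_antisymm hle₁ hle₂⟩
  | @tail U U' hU hs ih =>
    by_cases hj : j ≤ (U.filter fun v => lab v = true).card
    · exact ih hj
    · have hle := hs.card_filter_le fun v => lab v = true
      exact ⟨U', hs.card_eq.trans
        (SimpleGraph.connected_of_reflTransGen_connectedExchange h₁c hU).2,
        hs.connected, by omega⟩
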